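/- Let $G = ([m], E)$ be a simple undirected graph and let $r_v \geq 2$ for each $v \in [m]$. Work in $R = \mathbb{R}[p_x : x \in \prod_v [r_v]]$. Let $I(\mathcal{M}_G)$ be the kernel of the ring homomorphism $\varphi$ from $R$ to the polynomial ring in indeterminates $a^{(C)}_{y}$, indexed by pairs of a maximal clique $C$ of $G$ and an assignment $y \in \prod_{v \in C}[r_v]$, which sends $p_x \mapsto \prod_{C \text{ maximal clique}} a^{(C)}_{x_C}$ (where $x_C$ is the restriction of $x$ to $C$). Let $I_{\mathrm{global}(G)}$ be the sum, over all triples $(A, B, S)$ of pairwise disjoint subsets of $[m]$ with $A, B$ nonempty such that every path in $G$ from a vertex of $A$ to a vertex of $B$ passes through $S$, of the conditional independence ideals $I_{A \perp B \mid S}$ (generated by the quadrics $q(i_A,i_B,i_S)q(j_A,j_B,i_S) - q(i_A,j_B,i_S)q(j_A,i_B,i_S)$, where $q$ denotes marginalization of the $p_x$ over the coordinates outside $A \cup B \cup S$). Then $I(\mathcal{M}_G) = I_{\mathrm{global}(G)}$ if and only if $G$ is chordal, i.e. $G$ has no induced cycle of length at least 4. -/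

import Mathlib

open MvPolynomial

variable {m : ℕ}

/-- A maximal clique of a simple graph, as a finset of vertices. -/
def IsMaximalClique (G : SimpleGraph (Fin m)) (C : Finset (Fin m)) : Prop :=
  G.IsClique (C : Set (Fin m)) ∧
    ∀ D : Finset (Fin m), G.IsClique (D : Set (Fin m)) → C ⊆ D → C = D

/-- The finset of maximal cliques of `G`. -/
noncomputable def maximalCliques (G : SimpleGraph (Fin m)) : Finset (Finset (Fin m)) :=
  @Finset.filter _ (fun C => IsMaximalClique G C) (Classical.decPred _) Finset.univ

/-- The vanishing ideal `I(𝓜_G)` of the discrete undirected graphical model: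
the kernel of the clique-potential parametrization
`p_x ↦ ∏_{C maximal clique} a^{(C)}_{x_C}`. -/
noncomputable def graphicalModelIdeal (G : SimpleGraph (Fin m)) (r : Fin m → ℕ) :
    Ideal (MvPolynomial ((v : Fin m) → Fin (r v)) ℝ) :=
  RingHom.ker (aeval (R := ℝ) (fun x : (v : Fin m) → Fin (r v) =>
    (∏ C ∈ maximalCliques G,
      X (⟨C, fun v => x v.1⟩ : Σ C : Finset (Fin m), ((v : C) → Fin (r v.1))) :
      MvPolynomial (Σ C : Finset (Fin m), ((v : C) → Fin (r v.1))) ℝ))).toRingHom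

/-- The formal marginalization over the coordinates outside `A ∪ B ∪ S`. -/
noncomputable def margin (r : Fin m → ℕ) (A B S : Finset (Fin m))
    (z : (v : Fin m) → Fin (r v)) :
    MvPolynomial ((v : Fin m) → Fin (r v)) ℝ :=
  ∑ x ∈ Finset.univ.filter (fun x : (v : Fin m) → Fin (r v) =>
      ∀ v ∈ A ∪ B ∪ S, x v = z v), X x

/-- Combine tuples: the `A`-coordinates from `u`, the `B`-coordinates from `v`,
the remaining coordinates from `w`. -/
def mix {r : Fin m → ℕ} (A B : Finset (Fin m))
    (u v w : (k : Fin m) → Fin (r k)) : (k : Fin m) → Fin (r k) :=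
  fun k => if k ∈ A then u k else if k ∈ B then v k else w k

/-- `S` separates `A` from `B` in `G`: every walk from a vertex of `A` to a
vertex of `B` passes through `S`. -/
def SeparatesIn (G : SimpleGraph (Fin m)) (A B S : Finset (Fin m)) : Prop :=
  ∀ a ∈ A, ∀ b ∈ B, ∀ w : G.Walk a b, ∃ s ∈ S, s ∈ w.support

/-- The global Markov conditional independence ideal `I_{global(G)}`: the sum of
the CI ideals `I_{A ⟂ B | S}` over all separating triples `(A, B, S)`. -/
noncomputable def globalMarkovIdeal (G : SimpleGraph (Fin m)) (r : Fin m → ℕ) :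
    Ideal (MvPolynomial ((v : Fin m) → Fin (r v)) ℝ) :=
  Ideal.span { f | ∃ A B S : Finset (Fin m),
    Disjoint A B ∧ Disjoint A S ∧ Disjoint B S ∧ A.Nonempty ∧ B.Nonempty ∧
    SeparatesIn G A B S ∧
    ∃ u v w : (k : Fin m) → Fin (r k),
      f = margin r A B S (mix A B u u w) * margin r A B S (mix A B v v w)
        - margin r A B S (mix A B u v w) * margin r A B S (mix A B v u w) }

/-- `G` is chordal: it has no induced cycle of length at least 4. -/
def IsChordal (G : SimpleGraph (Fin m)) : Prop :=
  ¬ ∃ (n : ℕ) (f : Fin (n + 4) → Fin m), Function.Injective f ∧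
      ∀ i j : Fin (n + 4), G.Adj (f i) (f j) ↔ (j = i + 1 ∨ i = j + 1)

/-! ### Simplicial vertices of chordal graphs -/

/-- The vertex `v` of `W` is simplicial in the subgraph of `G` induced on `W`. -/
def IsSimplicialIn (G : SimpleGraph (Fin m)) (W : Finset (Fin m)) (v : Fin m) : Prop :=
  v ∈ W ∧ ∀ a ∈ W, ∀ b ∈ W, G.Adj v a → G.Adj v b → a ≠ b → G.Adj a b

/-- The edges of `G` with both ends in `U`, as a graph on all vertices. -/
def edgesWithin (G : SimpleGraph (Fin m)) (U : Set (Fin m)) : SimpleGraph (Fin m) where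
  Adj a b := G.Adj a b ∧ a ∈ U ∧ b ∈ U
  symm := ⟨fun _ _ h => ⟨h.1.symm, h.2.2, h.2.1⟩⟩
  loopless := ⟨fun _ h => G.irrefl h.1⟩

theorem edgesWithin_mono (G : SimpleGraph (Fin m)) {U U' : Set (Fin m)} (h : U ⊆ U') :
    edgesWithin G U ≤ edgesWithin G U' :=
  fun _ _ hab => ⟨hab.1, h hab.2.1, h hab.2.2⟩

/-- An induced path on at least three vertices, together with a vertex adjacent exactly to its
two ends, is an induced cycle of length at least four. -/
theorem not_isChordal_of_induced_path {G : SimpleGraph (Fin m)} {n : ℕ} {p : ℕ → Fin m}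
    {x : Fin m} (hinj : ∀ i j, i < j → j ≤ n + 2 → p i ≠ p j)
    (hadj : ∀ i j, i < j → j ≤ n + 2 → (G.Adj (p i) (p j) ↔ j = i + 1))
    (hx : ∀ i ≤ n + 2, x ≠ p i)
    (hxadj : ∀ i ≤ n + 2, (G.Adj x (p i) ↔ i = 0 ∨ i = n + 2)) : ¬ IsChordal G := by
  have key : ∀ i j : Fin (n + 4), i < j →
      ((if (i : ℕ) ≤ n + 2 then p i else x) ≠ (if (j : ℕ) ≤ n + 2 then p j else x)) ∧
      (G.Adj (if (i : ℕ) ≤ n + 2 then p i else x) (if (j : ℕ) ≤ n + 2 then p j else x) ↔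
        (j = i + 1 ∨ i = j + 1)) := by
    intro i j hij
    have h1 : (j = i + 1 ∨ i = j + 1) ↔
        ((j : ℕ) = i + 1 ∨ ((i : ℕ) = 0 ∧ (j : ℕ) = n + 3)) := by
      have hi := i.2
      have hj := j.2
      have hij' : (i : ℕ) < j := hij
      have e1 := Fin.val_add_one i
      have e2 := Fin.val_add_one j
      simp only [Fin.ext_iff, Fin.val_last] at e1 e2 ⊢
      rw [e1, e2]
      split_ifs <;> omega
    rw [h1]
    have hij' : (i : ℕ) < j := hij
    have hj := j.2
    by_cases hj2 : (j : ℕ) ≤ n + 2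
    · rw [if_pos hj2, if_pos (by omega)]
      refine ⟨hinj _ _ hij' hj2, ?_⟩
      rw [hadj _ _ hij' hj2]
      omega
    · rw [if_neg hj2, if_pos (by omega)]
      refine ⟨(hx _ (by omega)).symm, ?_⟩
      rw [G.adj_comm, hxadj _ (by omega)]
      omega
  rw [IsChordal, not_not]
  refine ⟨n, fun i => if (i : ℕ) ≤ n + 2 then p i else x, ?_, ?_⟩
  · intro i j hij
    by_contra hne
    rcases lt_or_gt_of_ne hne with h | h
    · exact (key i j h).1 hij
    · exact (key j i h).1 hij.symm
  · intro i j
    rcases lt_trichotomy i j with h | h | h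
    · exact (key i j h).2
    · subst h
      have : i ≠ i + 1 := by
        have e1 := Fin.val_add_one i
        rw [Ne, Fin.ext_iff, e1]
        split_ifs with hl
        · subst hl
          simp
        · omega
      simp [this]
    · rw [G.adj_comm, (key j i h).2, or_comm]

/-- In a chordal graph, two neighbours of `x` which are joined by a path whose inner vertices are
neither `x` nor neighbours of `x` are equal or adjacent. -/
theorem IsChordal.adj_of_reachable {G : SimpleGraph (Fin m)} (hG : IsChordal G)
    {U : Set (Fin m)} {x s t : Fin m} (hxU : ∀ z ∈ U, z ≠ x ∧ ¬ G.Adj x z)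
    (hs : G.Adj x s) (ht : G.Adj x t) (hst : s ≠ t)
    (hr : (edgesWithin G (insert s (insert t U))).Reachable s t) : G.Adj s t := by
  by_contra hnadj
  set H := edgesWithin G (insert s (insert t U)) with hH
  obtain ⟨w, hw⟩ := hr.exists_walk_length_eq_dist
  have hlen : 1 < w.length := by
    rw [hw]
    exact hr.one_lt_dist_of_ne_of_not_adj hst fun h => hnadj h.1
  obtain ⟨n, hn⟩ : ∃ n, w.length = n + 2 := ⟨w.length - 2, by omega⟩
  have shortcut : ∀ i j, i ≤ j → j ≤ n + 2 → ∀ q : H.Walk (w.getVert i) (w.getVert j),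
      j ≤ i + q.length := by
    intro i j hij hj q
    have := SimpleGraph.dist_le (((w.take i).append q).append (w.drop j))
    rw [← hw] at this
    simp only [SimpleGraph.Walk.length_append, SimpleGraph.Walk.take_length,
      SimpleGraph.Walk.drop_length] at this
    omega
  have hinj : ∀ i j, i < j → j ≤ n + 2 → w.getVert i ≠ w.getVert j := by
    intro i j hij hj h
    have := shortcut i j hij.le hj (SimpleGraph.Walk.nil.copy rfl h)
    simp at this
    omega
  have hmem : ∀ i ≤ n + 2, w.getVert i ∈ insert s (insert t U) := by
    intro i hi
    rcases Nat.lt_or_ge i (n + 2) with h | h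
    · exact (w.adj_getVert_succ (by omega)).2.1
    · have : w.getVert i = t := w.getVert_of_length_le (by omega)
      simp [this]
  have h0 : w.getVert 0 = s := w.getVert_zero
  have hl : w.getVert (n + 2) = t := by rw [← hn]; exact w.getVert_length
  have hinner : ∀ i, 0 < i → i < n + 2 → w.getVert i ∈ U := by
    intro i hi hi2
    rcases hmem i hi2.le with h | h | h
    · exact absurd (h0.trans h.symm) (hinj 0 i hi hi2.le)
    · exact absurd (h.trans hl.symm) (hinj i _ hi2 le_rfl)
    · exact h
  refine not_isChordal_of_induced_path (n := n) (p := w.getVert) (x := x) hinj ?_ ?_ ?_ hG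
  · intro i j hij hj
    constructor
    · intro h
      have hH' : H.Adj (w.getVert i) (w.getVert j) := ⟨h, hmem i (by omega), hmem j hj⟩
      have := shortcut i j hij.le hj hH'.toWalk
      simp at this
      omega
    · rintro rfl
      exact (w.adj_getVert_succ (by omega)).1
  · intro i hi
    rcases Nat.eq_zero_or_pos i with rfl | hi0
    · rw [h0]; exact hs.ne
    rcases Nat.lt_or_ge i (n + 2) with h | h
    · exact (hxU _ (hinner i hi0 h)).1.symm
    · obtain rfl : i = n + 2 := by omega
      rw [hl]; exact ht.ne
  · intro i hi
    rcases Nat.eq_zero_or_pos i with rfl | hi0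
    · simp [h0, hs]
    rcases Nat.lt_or_ge i (n + 2) with h | h
    · exact iff_of_false (hxU _ (hinner i hi0 h)).2 (by omega)
    · obtain rfl : i = n + 2 := by omega
      simp [hl, ht]

/-- Dirac: in a chordal graph, a vertex which is not adjacent to all others has a simplicial
non-neighbour, and so every nonempty induced subgraph has a simplicial vertex. -/
theorem IsChordal.exists_isSimplicialIn_aux {G : SimpleGraph (Fin m)} (hG : IsChordal G)
    (W : Finset (Fin m)) :
    (∀ x ∈ W, (∃ y ∈ W, y ≠ x ∧ ¬ G.Adj x y) →
      ∃ z, IsSimplicialIn G W z ∧ z ≠ x ∧ ¬ G.Adj x z) ∧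
    (W.Nonempty → ∃ z, IsSimplicialIn G W z) := by
  classical
  induction W using Finset.strongInduction with
  | H W ih =>
  have first : ∀ x ∈ W, (∃ y ∈ W, y ≠ x ∧ ¬ G.Adj x y) →
      ∃ z, IsSimplicialIn G W z ∧ z ≠ x ∧ ¬ G.Adj x z := by
    rintro x hxW ⟨y, hyW, hyx, hxy⟩
    set U : Set (Fin m) := {z | z ∈ W ∧ z ≠ x ∧ ¬ G.Adj x z} with hU
    have hyU : y ∈ U := ⟨hyW, hyx, hxy⟩
    set C : Finset (Fin m) := W.filter fun z => (edgesWithin G U).Reachable y z with hC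
    have hyC : y ∈ C := by simp [hC, hyW]
    have hCU : ∀ z ∈ C, z ∈ U := by
      intro z hz
      obtain ⟨w⟩ := (Finset.mem_filter.1 hz).2
      cases w.reverse with
      | nil => exact hyU
      | cons h _ => exact h.2.1
    set S : Finset (Fin m) := W.filter fun z => z ∉ C ∧ ∃ c ∈ C, G.Adj z c with hS
    have hSx : ∀ s ∈ S, G.Adj x s := by
      intro s hs
      obtain ⟨hsW, hsC, c, hcC, hsc⟩ := Finset.mem_filter.1 hs
      by_contra hxs
      have hsx : s ≠ x := by
        rintro rfl
        exact (hCU c hcC).2.2 hsc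
      have hsU : s ∈ U := ⟨hsW, hsx, hxs⟩
      refine hsC (Finset.mem_filter.2 ⟨hsW, (Finset.mem_filter.1 hcC).2.trans ?_⟩)
      exact SimpleGraph.Adj.reachable ⟨hsc.symm, hCU c hcC, hsU⟩
    have hSS : ∀ s ∈ S, ∀ t ∈ S, s ≠ t → G.Adj s t := by
      intro s hs t ht hst
      refine hG.adj_of_reachable (U := U) (x := x) (fun z hz => hz.2) (hSx s hs) (hSx t ht) hst ?_
      obtain ⟨-, -, c, hcC, hsc⟩ := Finset.mem_filter.1 hs
      obtain ⟨-, -, d, hdC, htd⟩ := Finset.mem_filter.1 ht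
      have hcd : (edgesWithin G U).Reachable c d :=
        (Finset.mem_filter.1 hcC).2.symm.trans (Finset.mem_filter.1 hdC).2
      have h1 : (edgesWithin G (insert s (insert t U))).Adj s c :=
        ⟨hsc, by simp, by simp [hCU c hcC]⟩
      have h2 : (edgesWithin G (insert s (insert t U))).Adj d t :=
        ⟨htd.symm, by simp [hCU d hdC], by simp⟩
      refine h1.reachable.trans ((hcd.mono (edgesWithin_mono G ?_)).trans h2.reachable)
      exact fun z hz => by simp [hz]
    have hxC : x ∉ C := fun h => (hCU x h).2.1 rfl
    have hxS : x ∉ S := fun h => G.irrefl (hSx x h)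
    have hCW : C ⊆ W := Finset.filter_subset _ _
    have hSW : S ⊆ W := Finset.filter_subset _ _
    have hN : ∀ c ∈ C, ∀ a ∈ W, G.Adj c a → a ∈ C ∪ S := by
      intro c hc a ha hca
      by_cases haC : a ∈ C
      · exact Finset.mem_union_left _ haC
      · exact Finset.mem_union_right _ (Finset.mem_filter.2 ⟨ha, haC, c, hc, hca.symm⟩)
    suffices h : ∃ z ∈ C, IsSimplicialIn G (C ∪ S) z by
      obtain ⟨z, hzC, hz⟩ := h
      exact ⟨z, ⟨hCW hzC, fun a ha b hb haz hbz =>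
        hz.2 a (hN z hzC a ha haz) b (hN z hzC b hb hbz) haz hbz⟩, (hCU z hzC).2⟩
    by_cases hex : ∃ s ∈ S, ∃ c ∈ C ∪ S, c ≠ s ∧ ¬ G.Adj s c
    · obtain ⟨s, hs, hc⟩ := hex
      have hss : C ∪ S ⊂ W := Finset.ssubset_iff_of_subset (Finset.union_subset hCW hSW) |>.2
        ⟨x, hxW, by simp [hxC, hxS]⟩
      obtain ⟨z, hz, hzs, hsz⟩ := (ih _ hss).1 s (Finset.mem_union_right _ hs) hc
      refine ⟨z, ?_, hz⟩
      rcases Finset.mem_union.1 hz.1 with h | h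
      · exact h
      · exact absurd (hSS s hs z h hzs.symm) hsz
    · push Not at hex
      have hss : C ⊂ W := Finset.ssubset_iff_of_subset hCW |>.2 ⟨x, hxW, hxC⟩
      obtain ⟨z, hz⟩ := (ih _ hss).2 ⟨y, hyC⟩
      refine ⟨z, hz.1, Finset.mem_union_left _ hz.1, fun a ha b hb hza hzb hab => ?_⟩
      by_cases haS : a ∈ S
      · exact hex a haS b hb hab.symm
      by_cases hbS : b ∈ S
      · exact (hex b hbS a ha hab).symm
      · exact hz.2 a ((Finset.mem_union.1 ha).resolve_right haS) b
          ((Finset.mem_union.1 hb).resolve_right hbS) hza hzb hab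
  refine ⟨first, fun ⟨v, hv⟩ => ?_⟩
  by_cases hex : ∃ x ∈ W, ∃ y ∈ W, y ≠ x ∧ ¬ G.Adj x y
  · obtain ⟨x, hx, hy⟩ := hex
    obtain ⟨z, hz, -⟩ := first x hx hy
    exact ⟨z, hz⟩
  · push Not at hex
    exact ⟨v, hv, fun a ha b hb _ _ hab => hex a ha b hb hab.symm⟩

theorem IsChordal.exists_isSimplicialIn {G : SimpleGraph (Fin m)} (hG : IsChordal G)
    {W : Finset (Fin m)} (hW : W.Nonempty) : ∃ v, IsSimplicialIn G W v :=
  (hG.exists_isSimplicialIn_aux W).2 hW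

/-! ### The ideal of saturated swaps -/

/-- The set `T` splits the disagreement of `x` and `y` on `W` into parts not joined by an edge. -/
def IsSplit (G : SimpleGraph (Fin m)) {r : Fin m → ℕ} (W T : Finset (Fin m))
    (x y : (v : Fin m) → Fin (r v)) : Prop :=
  ∀ a ∈ W, ∀ b ∈ W, x a ≠ y a → x b ≠ y b → G.Adj a b → (a ∈ T ↔ b ∈ T)

/-- The ideal generated by the quadrics which exchange two states along a splitting set. -/
noncomputable def swapIdeal (G : SimpleGraph (Fin m)) (r : Fin m → ℕ) :
    Ideal (MvPolynomial ((v : Fin m) → Fin (r v)) ℝ) :=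
  Ideal.span {f | ∃ (x y : (v : Fin m) → Fin (r v)) (T : Finset (Fin m)),
    IsSplit G Finset.univ T x y ∧ f = X x * X y - X (T.piecewise x y) * X (T.piecewise y x)}

theorem globalMarkovIdeal_le_swapIdeal (G : SimpleGraph (Fin m)) (r : Fin m → ℕ) :
    globalMarkovIdeal G r ≤ swapIdeal G r := by
  classical
  refine Ideal.span_le.2 ?_
  rintro _ ⟨A, B, S, hAB, hAS, hBS, -, -, hsep, u, v, w, rfl⟩
  set T : Finset (Fin m) :=
    Finset.univ.filter fun z => ∃ a ∈ A, ∃ p : G.Walk a z, ∀ s ∈ S, s ∉ p.support with hT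
  have hAT : ∀ a ∈ A, a ∈ T := fun a ha => Finset.mem_filter.2 ⟨Finset.mem_univ _, a, ha, .nil,
    fun s hs h => Finset.disjoint_left.1 hAS ha (by simp at h; exact h ▸ hs)⟩
  have hBT : ∀ b ∈ B, b ∉ T := by
    intro b hb h
    obtain ⟨-, a, ha, p, hp⟩ := Finset.mem_filter.1 h
    obtain ⟨s, hs, hsp⟩ := hsep a ha b hb p
    exact hp s hs hsp
  have hTadj : ∀ a b, a ∈ T → b ∉ S → G.Adj a b → b ∈ T := by
    intro a b ha hb hab
    obtain ⟨-, c, hc, p, hp⟩ := Finset.mem_filter.1 ha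
    refine Finset.mem_filter.2 ⟨Finset.mem_univ _, c, hc, p.concat hab, fun s hs h => ?_⟩
    rw [SimpleGraph.Walk.support_concat] at h
    simp only [List.mem_append, List.mem_singleton] at h
    rcases h with h | rfl
    · exact hp s hs h
    · exact hb hs
  set F : ((k : Fin m) → Fin (r k)) → Finset ((k : Fin m) → Fin (r k)) :=
    fun z => Finset.univ.filter fun x => ∀ k ∈ A ∪ B ∪ S, x k = z k with hF
  have hmix : ∀ a b x : (k : Fin m) → Fin (r k), x ∈ F (mix A B a b w) ↔
      (∀ k ∈ A, x k = a k) ∧ (∀ k ∈ B, x k = b k) ∧ ∀ k ∈ S, x k = w k := by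
    intro a b x
    simp only [hF, Finset.mem_filter, Finset.mem_univ, true_and, Finset.mem_union]
    constructor
    · intro h
      refine ⟨fun k hk => ?_, fun k hk => ?_, fun k hk => ?_⟩
      · simpa [mix, hk] using h k (by simp [hk])
      · simpa [mix, hk, Finset.disjoint_right.1 hAB hk] using h k (by simp [hk])
      · simpa [mix, Finset.disjoint_right.1 hAS hk, Finset.disjoint_right.1 hBS hk]
          using h k (by simp [hk])
    · rintro ⟨h1, h2, h3⟩ k ((hk | hk) | hk)
      · simpa [mix, hk] using h1 k hk
      · simpa [mix, hk, Finset.disjoint_right.1 hAB hk] using h2 k hk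
      · simpa [mix, Finset.disjoint_right.1 hAS hk, Finset.disjoint_right.1 hBS hk] using h3 k hk
  have hpiece : ∀ a b c d x y : (k : Fin m) → Fin (r k), x ∈ F (mix A B a b w) →
      y ∈ F (mix A B c d w) → T.piecewise x y ∈ F (mix A B a d w) := by
    intro a b c d x y hx hy
    rw [hmix] at hx hy ⊢
    refine ⟨fun k hk => ?_, fun k hk => ?_, fun k hk => ?_⟩
    · rw [T.piecewise_eq_of_mem _ _ (hAT k hk), hx.1 k hk]
    · rw [T.piecewise_eq_of_notMem _ _ (hBT k hk), hy.2.1 k hk]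
    · by_cases h : k ∈ T
      · rw [T.piecewise_eq_of_mem _ _ h, hx.2.2 k hk]
      · rw [T.piecewise_eq_of_notMem _ _ h, hy.2.2 k hk]
  have hinv : ∀ x y : (k : Fin m) → Fin (r k),
      T.piecewise (T.piecewise x y) (T.piecewise y x) = x := by
    intro x y
    ext k
    by_cases h : k ∈ T <;> simp [h]
  have hsum : ∀ a b c d : (k : Fin m) → Fin (r k),
      margin r A B S (mix A B a b w) * margin r A B S (mix A B c d w) =
        ∑ q ∈ F (mix A B a b w) ×ˢ F (mix A B c d w), X q.1 * X q.2 := by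
    intro a b c d
    rw [Finset.sum_product' (f := fun x y => X x * X y), ← Finset.sum_mul_sum]
    rfl
  have hswap : ∑ q ∈ F (mix A B u v w) ×ˢ F (mix A B v u w),
        (X q.1 * X q.2 : MvPolynomial ((k : Fin m) → Fin (r k)) ℝ) =
      ∑ q ∈ F (mix A B u u w) ×ˢ F (mix A B v v w),
        X (T.piecewise q.1 q.2) * X (T.piecewise q.2 q.1) := by
    symm
    refine Finset.sum_nbij' (fun q => (T.piecewise q.1 q.2, T.piecewise q.2 q.1))
      (fun q => (T.piecewise q.1 q.2, T.piecewise q.2 q.1)) ?_ ?_ ?_ ?_ ?_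
    · intro q hq
      rw [Finset.mem_product] at hq ⊢
      exact ⟨hpiece _ _ _ _ _ _ hq.1 hq.2, hpiece _ _ _ _ _ _ hq.2 hq.1⟩
    · intro q hq
      rw [Finset.mem_product] at hq ⊢
      exact ⟨hpiece _ _ _ _ _ _ hq.1 hq.2, hpiece _ _ _ _ _ _ hq.2 hq.1⟩
    · intro q _
      simp [hinv]
    · intro q _
      simp [hinv]
    · intro q _
      rfl
  rw [hsum, hsum, hswap, ← Finset.sum_sub_distrib]
  refine Ideal.sum_mem _ fun q hq => Ideal.subset_span ⟨q.1, q.2, T, ?_, rfl⟩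
  rw [Finset.mem_product, hmix, hmix] at hq
  have hS : ∀ k, q.1 k ≠ q.2 k → k ∉ S := fun k hk hkS =>
    hk ((hq.1.2.2 k hkS).trans (hq.2.2.2 k hkS).symm)
  intro a _ b _ ha hb hab
  exact ⟨fun h => hTadj a b h (hS b hb) hab, fun h => hTadj b a h (hS a ha) hab.symm⟩

theorem swapIdeal_le_globalMarkovIdeal (G : SimpleGraph (Fin m)) (r : Fin m → ℕ) :
    swapIdeal G r ≤ globalMarkovIdeal G r := by
  classical
  refine Ideal.span_le.2 ?_
  rintro _ ⟨x, y, T, hT, rfl⟩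
  set A := T.filter fun k => x k ≠ y k with hA
  set B := Finset.univ.filter fun k => k ∉ T ∧ x k ≠ y k with hB
  set S := Finset.univ.filter fun k => x k = y k with hS
  rcases A.eq_empty_or_nonempty with hA0 | hA0
  · have h : ∀ k ∈ T, x k = y k := by simpa [hA, Finset.filter_eq_empty_iff] using hA0
    have h1 : T.piecewise x y = y := by
      ext k; by_cases hk : k ∈ T <;> simp [hk, h]
    have h2 : T.piecewise y x = x := by
      ext k; by_cases hk : k ∈ T <;> simp [hk, h]
    simp [h1, h2, mul_comm]
  rcases B.eq_empty_or_nonempty with hB0 | hB0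
  · have h : ∀ k ∉ T, x k = y k := by simpa [hB, Finset.filter_eq_empty_iff] using hB0
    have h1 : T.piecewise x y = x := by
      ext k; by_cases hk : k ∈ T <;> simp [hk, h]
    have h2 : T.piecewise y x = y := by
      ext k; by_cases hk : k ∈ T <;> simp [hk, h]
    simp [h1, h2]
  have hcover : ∀ k, k ∈ A ∪ B ∪ S := by
    intro k
    simp only [hA, hB, hS, Finset.mem_union, Finset.mem_filter, Finset.mem_univ, true_and]
    tauto
  have hmargin : ∀ z : (k : Fin m) → Fin (r k), margin r A B S z = X z := by
    intro z
    have : (Finset.univ.filter fun x : (k : Fin m) → Fin (r k) =>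
        ∀ v ∈ A ∪ B ∪ S, x v = z v) = {z} := by
      ext x
      simp only [Finset.mem_filter, Finset.mem_univ, true_and, Finset.mem_singleton, funext_iff]
      exact ⟨fun h k => h k (hcover k), fun h k _ => h k⟩
    rw [margin, this, Finset.sum_singleton]
  have hmixes : mix A B x x x = x ∧ mix A B y y x = y ∧ mix A B x y x = T.piecewise x y ∧
      mix A B y x x = T.piecewise y x := by
    refine ⟨?_, ?_, ?_, ?_⟩ <;>
    · funext k
      by_cases hk : k ∈ T <;> by_cases hxy : x k = y k <;> simp [mix, hA, hB, hk, hxy]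
  refine Ideal.subset_span ⟨A, B, S, ?_, ?_, ?_, hA0, hB0, ?_, x, y, x, ?_⟩
  · rw [Finset.disjoint_left]
    intro k
    simp +contextual [hA, hB]
  · rw [Finset.disjoint_left]
    intro k
    simp +contextual [hA, hS]
  · rw [Finset.disjoint_left]
    intro k
    simp +contextual [hB, hS]
  · intro a ha b hb p
    by_contra! hp
    have hdiff : ∀ k ∈ p.support, x k ≠ y k := fun k hk h =>
      hp k (by simp [hS, h]) hk
    have hall : ∀ {c d : Fin m} (p : G.Walk c d), (∀ k ∈ p.support, x k ≠ y k) → c ∈ T → d ∈ T := by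
      intro c d p
      induction p with
      | nil => exact fun _ h => h
      | cons h q ih =>
        intro hk hc
        refine ih (fun k hkq => hk k (by simp [hkq])) ?_
        exact (hT _ (Finset.mem_univ _) _ (Finset.mem_univ _) (hk _ (by simp))
          (hk _ (by simp)) h).1 hc
    exact (Finset.mem_filter.1 hb).2.1 (hall p hdiff (Finset.mem_filter.1 ha).1)
  · rw [hmargin, hmargin, hmargin, hmargin, hmixes.1, hmixes.2.1, hmixes.2.2.1, hmixes.2.2.2]

theorem globalMarkovIdeal_eq_swapIdeal (G : SimpleGraph (Fin m)) (r : Fin m → ℕ) :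
    globalMarkovIdeal G r = swapIdeal G r :=
  le_antisymm (globalMarkovIdeal_le_swapIdeal G r) (swapIdeal_le_globalMarkovIdeal G r)

/-- On a clique, exchanging two states along a splitting set either does nothing or exchanges
them completely. -/
theorem IsSplit.eq_or_swap_on_clique {G : SimpleGraph (Fin m)} {r : Fin m → ℕ}
    {W T C : Finset (Fin m)} {x y : (v : Fin m) → Fin (r v)} (h : IsSplit G W T x y)
    (hC : G.IsClique (C : Set (Fin m))) (hCW : C ⊆ W) :
    (∀ k ∈ C, T.piecewise x y k = x k ∧ T.piecewise y x k = y k) ∨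
      (∀ k ∈ C, T.piecewise x y k = y k ∧ T.piecewise y x k = x k) := by
  classical
  have hconst : ∀ a ∈ C, ∀ b ∈ C, x a ≠ y a → x b ≠ y b → a ∈ T → b ∈ T := by
    intro a ha b hb hxa hxb haT
    by_cases hab : a = b
    · exact hab ▸ haT
    · exact (h a (hCW ha) b (hCW hb) hxa hxb (hC ha hb hab)).1 haT
  by_cases hex : ∃ a ∈ C, x a ≠ y a ∧ a ∈ T
  · obtain ⟨a, ha, hxa, haT⟩ := hex
    left
    intro k hk
    by_cases hkT : k ∈ T
    · simp [hkT]
    · have : x k = y k := by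
        by_contra hne
        exact hkT (hconst a ha k hk hxa hne haT)
      simp [hkT, this]
  · push Not at hex
    right
    intro k hk
    by_cases hkT : k ∈ T
    · have : x k = y k := by
        by_contra hne
        exact hex k hk hne hkT
      simp [hkT, this]
    · simp [hkT]

theorem mem_graphicalModelIdeal {G : SimpleGraph (Fin m)} {r : Fin m → ℕ}
    {f : MvPolynomial ((v : Fin m) → Fin (r v)) ℝ} :
    f ∈ graphicalModelIdeal G r ↔
      aeval (R := ℝ) (fun x : (v : Fin m) → Fin (r v) => (∏ C ∈ maximalCliques G,
        X (⟨C, fun v => x v.1⟩ : Σ C : Finset (Fin m), ((v : C) → Fin (r v.1))) :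
        MvPolynomial (Σ C : Finset (Fin m), ((v : C) → Fin (r v.1))) ℝ)) f = 0 :=
  Iff.rfl

theorem isClique_of_mem_maximalCliques {G : SimpleGraph (Fin m)} {C : Finset (Fin m)}
    (hC : C ∈ maximalCliques G) : G.IsClique (C : Set (Fin m)) := by
  classical
  simp only [maximalCliques, Finset.mem_filter] at hC
  exact hC.2.1

theorem swapIdeal_le_graphicalModelIdeal (G : SimpleGraph (Fin m)) (r : Fin m → ℕ) :
    swapIdeal G r ≤ graphicalModelIdeal G r := by
  classical
  refine Ideal.span_le.2 ?_
  rintro _ ⟨x, y, T, hT, rfl⟩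
  rw [SetLike.mem_coe, mem_graphicalModelIdeal]
  simp only [map_sub, map_mul, aeval_X, ← Finset.prod_mul_distrib]
  rw [sub_eq_zero]
  refine Finset.prod_congr rfl fun C hC => ?_
  have key : ∀ z z' : (v : Fin m) → Fin (r v), (∀ k ∈ C, z k = z' k) →
      (fun v : C => z v.1) = fun v : C => z' v.1 := fun z z' h => funext fun v => h v.1 v.2
  rcases hT.eq_or_swap_on_clique (isClique_of_mem_maximalCliques hC) (Finset.subset_univ C)
    with h | h
  · rw [key _ _ fun k hk => (h k hk).1, key _ _ fun k hk => (h k hk).2]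
  · rw [key _ _ fun k hk => (h k hk).1, key _ _ fun k hk => (h k hk).2, mul_comm]

/-! ### Induced cycles obstruct generation by quadrics -/

/-- The state with value `α` at `a`, value `β` at `b`, value `γ` on `R` and zero elsewhere. -/
def blockState {r : Fin m → ℕ} (hr : ∀ v, 2 ≤ r v) (a b : Fin m) (R : Finset (Fin m))
    (α β γ : Bool) : (v : Fin m) → Fin (r v) :=
  fun v => ⟨(if v = a then α else if v = b then β else if v ∈ R then γ else false).toNat,
    (Bool.toNat_lt _).trans_le (hr v)⟩

theorem blockState_apply_eq_iff {r : Fin m → ℕ} (hr : ∀ v, 2 ≤ r v) (a b : Fin m)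
    (R : Finset (Fin m)) (α β γ α' β' γ' : Bool) (v : Fin m) :
    blockState hr a b R α β γ v = blockState hr a b R α' β' γ' v ↔
      (if v = a then α else if v = b then β else if v ∈ R then γ else false) =
        (if v = a then α' else if v = b then β' else if v ∈ R then γ' else false) := by
  rw [blockState, blockState, Fin.mk.injEq]
  refine ⟨fun h => ?_, fun h => by rw [h]⟩
  generalize (if v = a then α else if v = b then β else if v ∈ R then γ else false) = c at h ⊢
  generalize (if v = a then α' else if v = b then β' else if v ∈ R then γ' else false) = d at h ⊢
  revert c d
  decide

theorem piecewise_eq_or_swap {r : Fin m → ℕ} {x y : (v : Fin m) → Fin (r v)} {T : Finset (Fin m)}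
    (h : ∀ k l, x k ≠ y k → x l ≠ y l → k ∈ T → l ∈ T) :
    (T.piecewise x y = x ∧ T.piecewise y x = y) ∨
      (T.piecewise x y = y ∧ T.piecewise y x = x) := by
  have hsplit : IsSplit (⊤ : SimpleGraph (Fin m)) Finset.univ T x y :=
    fun a _ b _ ha hb _ => ⟨h a b ha hb, h b a hb ha⟩
  rcases hsplit.eq_or_swap_on_clique (C := Finset.univ)
    (fun a _ b _ hab => hab) (Finset.subset_univ _) with h | h
  · exact .inl ⟨funext fun k => (h k (Finset.mem_univ k)).1,
      funext fun k => (h k (Finset.mem_univ k)).2⟩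
  · exact .inr ⟨funext fun k => (h k (Finset.mem_univ k)).1,
      funext fun k => (h k (Finset.mem_univ k)).2⟩

theorem isChordal_of_graphicalModelIdeal_le_swapIdeal {G : SimpleGraph (Fin m)} {r : Fin m → ℕ}
    (hr : ∀ v, 2 ≤ r v) (hle : graphicalModelIdeal G r ≤ swapIdeal G r) : IsChordal G := by
  classical
  rintro ⟨n, f, hf, hadj⟩
  have hv1 : ((1 : Fin (n + 4)) : ℕ) = 1 := rfl
  have hv2 : ((2 : Fin (n + 4)) : ℕ) = 2 := rfl
  set R : Finset (Fin m) := (Finset.univ.filter fun j : Fin (n + 4) => 2 ≤ (j : ℕ)).image f with hR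
  have hmemR : ∀ j : Fin (n + 4), f j ∈ R ↔ 2 ≤ (j : ℕ) := by
    intro j
    simp [hR, hf.eq_iff]
  set a := f 0 with ha
  set b := f 1 with hb
  have hab : a ≠ b := by
    intro h
    have := congrArg Fin.val (hf h)
    simp at this
  have haR : a ∉ R := by simp [ha, hmemR]
  have hbR : b ∉ R := by simp [hb, hmemR]
  have hsucc : ∀ i j : Fin (n + 4), (j : ℕ) = i + 1 → G.Adj (f i) (f j) := by
    intro i j hij
    rw [hadj]
    left
    rw [Fin.ext_iff, hij, Fin.val_add_one, if_neg]
    intro h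
    have := j.2
    rw [Fin.ext_iff, Fin.val_last] at h
    omega
  have hadjab : G.Adj a b := hsucc 0 1 (by simp)
  have hadjb2 : G.Adj b (f 2) := hsucc 1 2 (by simp)
  have hadjal : G.Adj a (f (Fin.last (n + 3))) := by
    rw [ha, hadj]
    right
    simp
  have hnone : ∀ c ∈ R, G.Adj a c → G.Adj b c → False := by
    intro c hc h1 h2
    obtain ⟨j, hj, rfl⟩ := Finset.mem_image.1 hc
    have hj2 := (Finset.mem_filter.1 hj).2
    have hj4 := j.2
    rw [ha, hadj] at h1
    rw [hb, hadj] at h2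
    have e := Fin.val_add_one j
    simp only [Fin.ext_iff, Fin.val_last] at h1 h2 e
    have e1 : ((1 + 1 : Fin (n + 4)) : ℕ) = 2 := rfl
    rw [zero_add, hv1, Fin.val_zero] at h1
    rw [e1, hv1] at h2
    generalize ((j + 1 : Fin (n + 4)) : ℕ) = q at *
    split_ifs at e <;> omega
  set st := blockState hr a b R with hst
  -- the states with even number of blocks set, and the remaining ones
  set P : ((v : Fin m) → Fin (r v)) → Prop := fun x => ∃ α β, x = st α β (xor α β) with hP
  have hat : ∀ {α β γ α' β' γ' : Bool}, st α β γ a = st α' β' γ' a → α = α' := by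
    intro α β γ α' β' γ' h
    simpa [hst, blockState_apply_eq_iff] using h
  have hbt : ∀ {α β γ α' β' γ' : Bool}, st α β γ b = st α' β' γ' b → β = β' := by
    intro α β γ α' β' γ' h
    simpa [hst, blockState_apply_eq_iff, hab.symm] using h
  have hRt : ∀ {α β γ α' β' γ' : Bool} {c}, c ∈ R →
      (st α β γ c = st α' β' γ' c ↔ γ = γ') := by
    intro α β γ α' β' γ' c hc
    have h1 : c ≠ a := fun h => haR (h ▸ hc)
    have h2 : c ≠ b := fun h => hbR (h ▸ hc)
    simp [hst, blockState_apply_eq_iff, hc, h1, h2]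
  have hot : ∀ {α β γ α' β' γ' : Bool} {c}, c ≠ a → c ≠ b → c ∉ R →
      st α β γ c = st α' β' γ' c := by
    intro α β γ α' β' γ' c h1 h2 h3
    simp [hst, blockState_apply_eq_iff, h1, h2, h3]
  have h2R : f 2 ∈ R := (hmemR 2).2 hv2.ge
  have hodd : ∀ α β, ¬ P (st α β (!xor α β)) := by
    rintro α β ⟨α', β', h⟩
    obtain rfl := hat (congrFun h a)
    obtain rfl := hbt (congrFun h b)
    have := (hRt h2R).1 (congrFun h _)
    simp at this
  have hconn : ∀ x y T, IsSplit G Finset.univ T x y → P x → P y →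
      (T.piecewise x y = x ∧ T.piecewise y x = y) ∨
        (T.piecewise x y = y ∧ T.piecewise y x = x) := by
    rintro x y T hT ⟨α, β, rfl⟩ ⟨α', β', rfl⟩
    refine piecewise_eq_or_swap ?_
    set x := st α β (xor α β) with hx
    set y := st α' β' (xor α' β') with hy
    have hT' : ∀ k l, x k ≠ y k → x l ≠ y l → G.Adj k l → (k ∈ T ↔ l ∈ T) :=
      fun k l => hT k (Finset.mem_univ _) l (Finset.mem_univ _)
    have hcases : ∀ k, x k ≠ y k → k = a ∨ k = b ∨ k ∈ R := by
      intro k hk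
      by_contra! h
      exact hk (hot h.1 h.2.1 h.2.2)
    by_cases hγ : xor α β = xor α' β'
    · have hcases' : ∀ k, x k ≠ y k → k = a ∨ k = b := by
        intro k hk
        rcases hcases k hk with h | h | h
        · exact .inl h
        · exact .inr h
        · exact absurd ((hRt h).2 hγ) hk
      intro k l hk hl hkT
      rcases hcases' k hk with rfl | rfl <;> rcases hcases' l hl with rfl | rfl
      · exact hkT
      · exact (hT' _ _ hk hl hadjab).1 hkT
      · exact (hT' _ _ hk hl hadjab.symm).1 hkT
      · exact hkT
    · have hRd : ∀ c ∈ R, x c ≠ y c := fun c hc h => hγ ((hRt hc).1 h)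
      have hRT : ∀ i : ℕ, ∀ hi : i + 2 < n + 4, (f ⟨i + 2, hi⟩ ∈ T ↔ f 2 ∈ T) := by
        intro i
        induction i with
        | zero => exact fun hi => Iff.rfl
        | succ i ih =>
          intro hi
          rw [← ih (by omega)]
          refine hT' _ _ (hRd _ ((hmemR _).2 (by simp))) (hRd _ ((hmemR _).2 (by simp))) ?_
          exact (hsucc _ _ rfl).symm
      have hall : ∀ k, x k ≠ y k → (k ∈ T ↔ f 2 ∈ T) := by
        intro k hk
        rcases hcases k hk with rfl | rfl | h
        · have hl : Fin.last (n + 3) = ⟨n + 1 + 2, by omega⟩ := rfl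
          rw [hT' _ _ hk (hRd _ ((hmemR _).2 (by simp))) hadjal, hl]
          exact hRT _ _
        · exact hT' _ _ hk (hRd _ h2R) hadjb2
        · obtain ⟨j, hj, rfl⟩ := Finset.mem_image.1 h
          have hj2 := (Finset.mem_filter.1 hj).2
          have hj4 := j.2
          have : j = ⟨(j - 2 : ℕ) + 2, by omega⟩ := Fin.ext (by simp; omega)
          rw [this]
          exact hRT _ _
      intro k l hk hl hkT
      exact (hall l hl).2 ((hall k hk).1 hkT)
  set g : ((v : Fin m) → Fin (r v)) → ℝ := fun x => if P x then 1 else 0 with hg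
  have hgswap : ∀ x y T, IsSplit G Finset.univ T x y →
      g x * g y = g (T.piecewise x y) * g (T.piecewise y x) := by
    intro x y T hT
    by_cases h1 : P x ∧ P y
    · rcases hconn x y T hT h1.1 h1.2 with h | h
      · rw [h.1, h.2]
      · rw [h.1, h.2, mul_comm]
    by_cases h2 : P (T.piecewise x y) ∧ P (T.piecewise y x)
    · have hT2 : IsSplit G Finset.univ T (T.piecewise x y) (T.piecewise y x) := by
        have hne : ∀ k, T.piecewise x y k ≠ T.piecewise y x k → x k ≠ y k := by
          intro k
          by_cases hk : k ∈ T <;> simp +contextual [hk, eq_comm]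
        exact fun c hc d hd hxc hxd => hT c hc d hd (hne c hxc) (hne d hxd)
      have e : ∀ x y : (v : Fin m) → Fin (r v),
          T.piecewise (T.piecewise x y) (T.piecewise y x) = x := by
        intro x y
        ext k
        by_cases h : k ∈ T <;> simp [h]
      have := hconn _ _ T hT2 h2.1 h2.2
      rw [e, e] at this
      rcases this with h | h
      · rw [← h.1, ← h.2]
      · rw [← h.1, ← h.2, mul_comm]
    · have z : ∀ x y, ¬ (P x ∧ P y) → g x * g y = 0 := by
        intro x y h
        rcases not_and_or.1 h with h | h <;> simp only [hg, if_neg h, zero_mul, mul_zero]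
      rw [z _ _ h1, z _ _ h2]
  have hker : swapIdeal G r ≤ RingHom.ker (eval g) := by
    refine Ideal.span_le.2 ?_
    rintro _ ⟨x, y, T, hT, rfl⟩
    rw [SetLike.mem_coe, RingHom.mem_ker]
    simp [hgswap x y T hT]
  have hmem : (∏ q : Bool × Bool, X (st q.1 q.2 (xor q.1 q.2)) -
      ∏ q : Bool × Bool, X (st q.1 q.2 (!xor q.1 q.2)) :
        MvPolynomial ((v : Fin m) → Fin (r v)) ℝ) ∈ graphicalModelIdeal G r := by
    rw [mem_graphicalModelIdeal]
    simp only [map_sub, map_prod, aeval_X]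
    rw [sub_eq_zero, Finset.prod_comm, Finset.prod_comm (s := Finset.univ)]
    refine Finset.prod_congr rfl fun C hC => ?_
    have hCl := isClique_of_mem_maximalCliques hC
    have key : ∀ x y : (v : Fin m) → Fin (r v), (∀ k ∈ C, x k = y k) →
        (X (⟨C, fun v => x v.1⟩ : Σ C : Finset (Fin m), ((v : C) → Fin (r v.1))) :
          MvPolynomial (Σ C : Finset (Fin m), ((v : C) → Fin (r v.1))) ℝ) =
        X ⟨C, fun v => y v.1⟩ := by
      intro x y h
      rw [show (fun v : C => x v.1) = fun v : C => y v.1 from funext fun v => h v.1 v.2]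
    by_cases haC : a ∈ C
    · by_cases hbC : b ∈ C
      · refine Finset.prod_congr rfl fun q _ => key _ _ fun k hk => ?_
        have hkR : k ∉ R := fun hkR => hnone k hkR
          (hCl haC hk fun h => haR (h ▸ hkR)) (hCl hbC hk fun h => hbR (h ▸ hkR))
        simp [hst, blockState_apply_eq_iff, hkR]
      · refine Fintype.prod_equiv ((Equiv.refl _).prodCongr Equiv.boolNot) _ _ fun q => ?_
        refine key _ _ fun k hk => ?_
        have hkb : k ≠ b := fun h => hbC (h ▸ hk)
        simp [hst, blockState_apply_eq_iff, hkb]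
    · refine Fintype.prod_equiv (Equiv.boolNot.prodCongr (Equiv.refl _)) _ _ fun q => ?_
      refine key _ _ fun k hk => ?_
      have hka : k ≠ a := fun h => haC (h ▸ hk)
      simp [hst, blockState_apply_eq_iff, hka]
  have h0 := hker (hle hmem)
  rw [RingHom.mem_ker, map_sub, map_prod, map_prod] at h0
  have h1 : ∏ q : Bool × Bool, eval g (X (st q.1 q.2 (xor q.1 q.2))) = 1 := by
    refine Finset.prod_eq_one fun q _ => ?_
    rw [eval_X]
    exact if_pos ⟨_, _, rfl⟩
  have h2 : ∏ q : Bool × Bool, eval g (X (st q.1 q.2 (!xor q.1 q.2))) = 0 := by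
    refine Finset.prod_eq_zero (Finset.mem_univ (true, true)) ?_
    rw [eval_X]
    exact if_neg (hodd _ _)
  rw [h1, h2] at h0
  norm_num at h0

/-! ### Fibers of a chordal graph are connected by swaps -/

/-- One move on a family of states: two members are exchanged along a splitting set. -/
def SwapStep (G : SimpleGraph (Fin m)) {r : Fin m → ℕ} {ι : Type} (W : Finset (Fin m))
    (s s' : ι → (v : Fin m) → Fin (r v)) : Prop :=
  ∃ (i j : ι) (T : Finset (Fin m)), i ≠ j ∧ IsSplit G W T (s i) (s j) ∧
    s' i = T.piecewise (s i) (s j) ∧ s' j = T.piecewise (s j) (s i) ∧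
    ∀ k, k ≠ i → k ≠ j → s' k = s k

/-- The families `s` and `t` have the same marginal table on `C`. -/
def SameMarginal {r : Fin m → ℕ} {ι : Type} [Fintype ι] (C : Finset (Fin m))
    (s t : ι → (v : Fin m) → Fin (r v)) : Prop :=
  ∀ y : (v : Fin m) → Fin (r v), (Finset.univ.filter fun i => ∀ v ∈ C, s i v = y v).card =
    (Finset.univ.filter fun i => ∀ v ∈ C, t i v = y v).card

theorem SwapStep.sameMarginal {G : SimpleGraph (Fin m)} {r : Fin m → ℕ} {ι : Type} [Fintype ι]
    {W C : Finset (Fin m)} {s s' : ι → (v : Fin m) → Fin (r v)} (h : SwapStep G W s s')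
    (hC : G.IsClique (C : Set (Fin m))) (hCW : C ⊆ W) : SameMarginal C s s' := by
  classical
  obtain ⟨i, j, T, hij, hT, hi, hj, hk⟩ := h
  intro y
  rcases hT.eq_or_swap_on_clique hC hCW with h | h
  · congr 1
    ext k
    simp only [Finset.mem_filter, Finset.mem_univ, true_and]
    refine forall₂_congr fun v hv => ?_
    by_cases hki : k = i
    · rw [hki, hi, (h v hv).1]
    by_cases hkj : k = j
    · rw [hkj, hj, (h v hv).2]
    rw [hk k hki hkj]
  · refine Finset.card_equiv (Equiv.swap i j) fun k => ?_
    simp only [Finset.mem_filter, Finset.mem_univ, true_and]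
    refine forall₂_congr fun v hv => ?_
    by_cases hki : k = i
    · rw [hki, Equiv.swap_apply_left, hj, (h v hv).2]
    by_cases hkj : k = j
    · rw [hkj, Equiv.swap_apply_right, hi, (h v hv).1]
    rw [Equiv.swap_apply_of_ne_of_ne hki hkj, hk k hki hkj]

theorem sameMarginal_of_reflTransGen {G : SimpleGraph (Fin m)} {r : Fin m → ℕ} {ι : Type}
    [Fintype ι] {W C : Finset (Fin m)} {s s' : ι → (v : Fin m) → Fin (r v)}
    (h : Relation.ReflTransGen (SwapStep G W) s s')
    (hC : G.IsClique (C : Set (Fin m))) (hCW : C ⊆ W) : SameMarginal C s s' := by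
  induction h with
  | refl => exact fun _ => rfl
  | tail _ h ih => exact fun y => (ih y).trans (h.sameMarginal hC hCW y)

/-- A move on the vertices other than a simplicial vertex extends to a move on all vertices. -/
theorem SwapStep.exists_lift {G : SimpleGraph (Fin m)} {r : Fin m → ℕ} {ι : Type}
    {W : Finset (Fin m)} {v : Fin m} (hv : IsSimplicialIn G W v)
    {s s' u : ι → (v : Fin m) → Fin (r v)} (h : SwapStep G (W.erase v) s s')
    (hu : ∀ i, ∀ k ∈ W.erase v, u i k = s i k) :
    ∃ u', SwapStep G W u u' ∧ ∀ i, ∀ k ∈ W.erase v, u' i k = s' i k := by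
  classical
  obtain ⟨i, j, T, hij, hT, hi, hj, hk⟩ := h
  obtain ⟨T', hTT', hvT'⟩ : ∃ T' : Finset (Fin m), (∀ k, k ≠ v → (k ∈ T' ↔ k ∈ T)) ∧
      ∀ b ∈ W.erase v, s i b ≠ s j b → G.Adj v b → (v ∈ T' ↔ b ∈ T') := by
    by_cases hex : ∃ a ∈ W.erase v, s i a ≠ s j a ∧ G.Adj v a ∧ a ∈ T
    · obtain ⟨a, ha, hsa, hva, haT⟩ := hex
      refine ⟨insert v T, fun k hkv => by simp [hkv], fun b hb hsb hvb => ?_⟩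
      simp only [Finset.mem_insert, true_or, true_iff]
      right
      by_cases hab : a = b
      · exact hab ▸ haT
      · exact (hT a ha b hb hsa hsb (hv.2 a (Finset.mem_of_mem_erase ha) b
          (Finset.mem_of_mem_erase hb) hva hvb hab)).1 haT
    · push Not at hex
      refine ⟨T.erase v, fun k hkv => by simp [hkv], fun b hb hsb hvb => ?_⟩
      simp [hex b hb hsb hvb]
  refine ⟨fun k => if k = i then T'.piecewise (u i) (u j) else
    if k = j then T'.piecewise (u j) (u i) else u k,
    ⟨i, j, T', hij, ?_, by simp, by simp [hij.symm], fun k h1 h2 => by simp [h1, h2]⟩, ?_⟩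
  · intro a ha b hb hua hub hab
    by_cases hav : a = v
    · subst hav
      have hb' : b ∈ W.erase a := Finset.mem_erase.2 ⟨hab.ne', hb⟩
      rw [hu i b hb', hu j b hb'] at hub
      exact hvT' b hb' hub hab
    have ha' : a ∈ W.erase v := Finset.mem_erase.2 ⟨hav, ha⟩
    rw [hu i a ha', hu j a ha'] at hua
    by_cases hbv : b = v
    · subst hbv
      exact (hvT' a ha' hua hab.symm).symm
    have hb' : b ∈ W.erase v := Finset.mem_erase.2 ⟨hbv, hb⟩
    rw [hu i b hb', hu j b hb'] at hub
    rw [hTT' a hav, hTT' b hbv]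
    exact hT a ha' b hb' hua hub hab
  · intro k l hl
    have hlv := Finset.ne_of_mem_erase hl
    have hpw : ∀ p q p' q' : (v : Fin m) → Fin (r v), p l = p' l → q l = q' l →
        T'.piecewise p q l = T.piecewise p' q' l := by
      intro p q p' q' h1 h2
      by_cases h : l ∈ T
      · simp [h, (hTT' l hlv).2 h, h1]
      · simp [h, (hTT' l hlv).not.2 h, h2]
    by_cases hki : k = i
    · simp only [hki, if_true, hi]
      exact hpw _ _ _ _ (hu i l hl) (hu j l hl)
    by_cases hkj : k = j
    · simp only [hkj, hij.symm, if_true, if_false, hj]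
      exact hpw _ _ _ _ (hu j l hl) (hu i l hl)
    · simp only [hki, hkj, if_false, hk k hki hkj]
      exact hu k l hl

theorem exists_lift_of_reflTransGen {G : SimpleGraph (Fin m)} {r : Fin m → ℕ} {ι : Type}
    {W : Finset (Fin m)} {v : Fin m} (hv : IsSimplicialIn G W v)
    {s s' : ι → (v : Fin m) → Fin (r v)}
    (h : Relation.ReflTransGen (SwapStep G (W.erase v)) s s') :
    ∃ u, Relation.ReflTransGen (SwapStep G W) s u ∧ ∀ i, ∀ k ∈ W.erase v, u i k = s' i k := by
  induction h with
  | refl => exact ⟨s, .refl, fun _ _ _ => rfl⟩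
  | tail _ h ih =>
    obtain ⟨u, hu, hus⟩ := ih
    obtain ⟨u', hu', hus'⟩ := h.exists_lift hv hus
    exact ⟨u', hu.tail hu', hus'⟩

/-- Families which agree off a vertex `v` and have the same marginal on a set containing `v` and
its neighbours are connected by moves. -/
theorem exists_reflTransGen_of_agree_erase {G : SimpleGraph (Fin m)} {r : Fin m → ℕ} {ι : Type}
    [Fintype ι] {W C : Finset (Fin m)} {v : Fin m} (hvC : v ∈ C) (hCW : C ⊆ W)
    (hN : ∀ a ∈ W, G.Adj v a → a ∈ C) (hC : G.IsClique (C : Set (Fin m)))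
    (t s : ι → (v : Fin m) → Fin (r v)) (hst : ∀ i, ∀ k ∈ W.erase v, s i k = t i k)
    (hmarg : SameMarginal C s t) :
    ∃ s', Relation.ReflTransGen (SwapStep G W) s s' ∧ ∀ i, ∀ k ∈ W, s' i k = t i k := by
  classical
  induction hn : (Finset.univ.filter fun i => s i v ≠ t i v).card using Nat.strong_induction_on
    generalizing s with
  | _ n ih =>
  by_cases hex : ∃ i, s i v ≠ t i v
  swap
  · push Not at hex
    refine ⟨s, .refl, fun i k hk => ?_⟩
    by_cases hkv : k = v
    · exact hkv ▸ hex i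
    · exact hst i k (Finset.mem_erase.2 ⟨hkv, hk⟩)
  obtain ⟨i, hi⟩ := hex
  obtain ⟨j, hsj, htj⟩ : ∃ j, (∀ k ∈ C, s j k = t i k) ∧ ¬ ∀ k ∈ C, t j k = t i k := by
    by_contra! hcon
    refine (hmarg (t i)).not_lt (Finset.card_lt_card ((Finset.ssubset_iff_of_subset ?_).2 ⟨i, ?_⟩))
    · intro j hj
      exact Finset.mem_filter.2 ⟨Finset.mem_univ _, hcon j (Finset.mem_filter.1 hj).2⟩
    · simp only [Finset.mem_filter, Finset.mem_univ, true_and]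
      exact ⟨fun _ _ => trivial, fun h => hi (h v hvC)⟩
  have htjv : t j v ≠ t i v := by
    intro h
    refine htj fun k hk => ?_
    by_cases hkv : k = v
    · exact hkv ▸ h
    · rw [← hst j k (Finset.mem_erase.2 ⟨hkv, hCW hk⟩), hsj k hk]
  have hsjv : s j v = t i v := hsj v hvC
  have hij : i ≠ j := by
    rintro rfl
    exact hi hsjv
  set T : Finset (Fin m) := Finset.univ.erase v with hT
  have hvT : v ∉ T := by simp [hT]
  have hkT : ∀ k, k ≠ v → k ∈ T := fun k hk => by simp [hT, hk]
  set s' : ι → (v : Fin m) → Fin (r v) := fun k => if k = i then T.piecewise (s i) (s j) else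
    if k = j then T.piecewise (s j) (s i) else s k with hs'
  have hoff : ∀ k l, l ≠ v → s' k l = s k l := by
    intro k l hl
    by_cases hki : k = i
    · simp [hs', hki, hkT l hl]
    by_cases hkj : k = j
    · simp [hs', hkj, hij.symm, hkT l hl]
    simp [hs', hki, hkj]
  have hsplit : ∀ a ∈ W, s i a ≠ s j a → ¬ G.Adj v a := by
    intro a ha hne hva
    refine hne ?_
    rw [hsj a (hN a ha hva), hst i a (Finset.mem_erase.2 ⟨hva.ne', ha⟩)]
  have hstep : SwapStep G W s s' := by
    refine ⟨i, j, T, hij, ?_, by simp [hs'], by simp [hs', hij.symm],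
      fun k h1 h2 => by simp [hs', h1, h2]⟩
    intro a ha b hb hsa hsb hab
    have h1 : a ≠ v := by
      rintro rfl
      exact hsplit b hb hsb hab
    have h2 : b ≠ v := by
      rintro rfl
      exact hsplit a ha hsa hab.symm
    exact iff_of_true (hkT a h1) (hkT b h2)
  have hs'i : s' i v = t i v := by simp [hs', hvT, hsjv]
  have hlt : (Finset.univ.filter fun k => s' k v ≠ t k v).card < n := by
    rw [← hn]
    refine Finset.card_lt_card ((Finset.ssubset_iff_of_subset ?_).2 ⟨i, by simpa using hi, ?_⟩)
    · intro k hk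
      simp only [Finset.mem_filter, Finset.mem_univ, true_and] at hk ⊢
      by_cases hki : k = i
      · exact hki ▸ hi
      by_cases hkj : k = j
      · rw [hkj, hsjv]
        exact htjv.symm
      · simpa [hs', hki, hkj] using hk
    · simp [hs'i]
  obtain ⟨s'', hs'', h⟩ := ih _ hlt s' (fun k l hl => by
      rw [hoff k l (Finset.ne_of_mem_erase hl), hst k l hl])
    (fun y => ((hstep.sameMarginal hC hCW y).symm).trans (hmarg y)) rfl
  exact ⟨s'', hs''.head hstep, h⟩

/-- In a chordal graph, families with the same clique marginals are connected by moves. -/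
theorem IsChordal.exists_reflTransGen {G : SimpleGraph (Fin m)} (hG : IsChordal G)
    {r : Fin m → ℕ} {ι : Type} [Fintype ι] (s t : ι → (v : Fin m) → Fin (r v))
    (W : Finset (Fin m))
    (hmarg : ∀ C : Finset (Fin m), G.IsClique (C : Set (Fin m)) → SameMarginal C s t) :
    ∃ s', Relation.ReflTransGen (SwapStep G W) s s' ∧ ∀ i, ∀ k ∈ W, s' i k = t i k := by
  classical
  induction W using Finset.strongInduction with
  | H W ih =>
  rcases W.eq_empty_or_nonempty with rfl | hW
  · exact ⟨s, .refl, by simp⟩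
  obtain ⟨v, hv⟩ := hG.exists_isSimplicialIn hW
  obtain ⟨s₁, hs₁, hst₁⟩ := ih (W.erase v) (Finset.erase_ssubset hv.1)
  obtain ⟨s₂, hs₂, hst₂⟩ := exists_lift_of_reflTransGen hv hs₁
  set C := insert v (W.filter fun a => G.Adj v a) with hC
  have hCW : C ⊆ W := Finset.insert_subset hv.1 (Finset.filter_subset _ _)
  have hCl : G.IsClique (C : Set (Fin m)) := by
    intro a ha b hb hab
    simp only [hC, Finset.coe_insert, Finset.coe_filter, Set.mem_insert_iff,
      Set.mem_ofPred_eq] at ha hb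
    rcases ha with rfl | ⟨haW, hva⟩ <;> rcases hb with rfl | ⟨hbW, hvb⟩
    · exact absurd rfl hab
    · exact hvb
    · exact hva.symm
    · exact hv.2 a haW b hbW hva hvb hab
  obtain ⟨s₃, hs₃, hst₃⟩ := exists_reflTransGen_of_agree_erase (Finset.mem_insert_self _ _) hCW
    (fun a ha hva => Finset.mem_insert_of_mem (Finset.mem_filter.2 ⟨ha, hva⟩)) hCl t s₂
    (fun i k hk => (hst₂ i k hk).trans (hst₁ i k hk))
    (fun y => (sameMarginal_of_reflTransGen hs₂ hCl hCW y).symm.trans (hmarg C hCl y))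
  exact ⟨s₃, hs₂.trans hs₃, hst₃⟩

/-! ### The toric ideal is spanned by binomials -/

theorem SwapStep.prod_sub_prod_mem {G : SimpleGraph (Fin m)} {r : Fin m → ℕ} {ι : Type}
    [Fintype ι] {s s' : ι → (v : Fin m) → Fin (r v)} (h : SwapStep G Finset.univ s s') :
    (∏ i, X (s i) - ∏ i, X (s' i) : MvPolynomial ((v : Fin m) → Fin (r v)) ℝ) ∈
      swapIdeal G r := by
  classical
  obtain ⟨i, j, T, hij, hT, hi, hj, hk⟩ := h
  have hprod : ∀ u : ι → (v : Fin m) → Fin (r v),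
      (∏ k, X (u k) : MvPolynomial ((v : Fin m) → Fin (r v)) ℝ) =
        X (u i) * X (u j) * ∏ k ∈ (Finset.univ.erase i).erase j, X (u k) := by
    intro u
    rw [mul_assoc, Finset.mul_prod_erase _ (fun k => X (u k)) (by simp [hij.symm]),
      Finset.mul_prod_erase _ (fun k => X (u k)) (Finset.mem_univ i)]
  have hrest : (∏ k ∈ (Finset.univ.erase i).erase j, X (s' k) :
      MvPolynomial ((v : Fin m) → Fin (r v)) ℝ) =
      ∏ k ∈ (Finset.univ.erase i).erase j, X (s k) := by
    refine Finset.prod_congr rfl fun k hk' => ?_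
    simp only [Finset.mem_erase, Finset.mem_univ, and_true] at hk'
    rw [hk k hk'.2 hk'.1]
  rw [hprod, hprod, hrest, ← sub_mul, hi, hj]
  exact Ideal.mul_mem_right _ _ (Ideal.subset_span ⟨s i, s j, T, hT, rfl⟩)

theorem IsChordal.prod_sub_prod_mem {G : SimpleGraph (Fin m)} (hG : IsChordal G)
    {r : Fin m → ℕ} {ι : Type} [Fintype ι] (s t : ι → (v : Fin m) → Fin (r v))
    (hmarg : ∀ C : Finset (Fin m), G.IsClique (C : Set (Fin m)) → SameMarginal C s t) :
    (∏ i, X (s i) - ∏ i, X (t i) : MvPolynomial ((v : Fin m) → Fin (r v)) ℝ) ∈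
      swapIdeal G r := by
  obtain ⟨s', hs', hst⟩ := hG.exists_reflTransGen s t Finset.univ hmarg
  obtain rfl : s' = t := funext fun i => funext fun k => hst i k (Finset.mem_univ k)
  clear hst hmarg
  induction hs' with
  | refl => simp
  | tail _ h ih =>
    have := Ideal.add_mem _ ih h.prod_sub_prod_mem
    rwa [sub_add_sub_cancel] at this

/-- If an algebra homomorphism sends monomials to monomials, an ideal which contains the
differences of all monomials with equal images contains the kernel. -/
theorem ker_le_of_monomial_sub_monomial_mem {σ τ : Type*}
    (φ : MvPolynomial σ ℝ →ₐ[ℝ] MvPolynomial τ ℝ) (e : (σ →₀ ℕ) → (τ →₀ ℕ))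
    (hφ : ∀ d, φ (monomial d 1) = monomial (e d) 1) (I : Ideal (MvPolynomial σ ℝ))
    (hI : ∀ d d', e d = e d' → monomial d 1 - monomial d' 1 ∈ I) :
    RingHom.ker φ.toRingHom ≤ I := by
  let ψ : MvPolynomial τ ℝ →ₗ[ℝ] MvPolynomial σ ℝ :=
    (basisMonomials τ ℝ).constr ℝ fun d => monomial (Function.invFun e d) 1
  have hψ : (Ideal.Quotient.mkₐ ℝ I).toLinearMap ∘ₗ ψ ∘ₗ φ.toLinearMap =
      (Ideal.Quotient.mkₐ ℝ I).toLinearMap := by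
    refine (basisMonomials σ ℝ).ext fun d => ?_
    have h1 : ψ (monomial (e d) 1) = monomial (Function.invFun e (e d)) 1 := by
      have := (basisMonomials τ ℝ).constr_basis ℝ
        (fun d => (monomial (Function.invFun e d) 1 : MvPolynomial σ ℝ)) (e d)
      rwa [coe_basisMonomials] at this
    simp only [coe_basisMonomials, LinearMap.comp_apply, AlgHom.toLinearMap_apply, hφ, h1]
    exact Ideal.Quotient.eq.2 (hI _ _ (Function.invFun_eq ⟨d, rfl⟩))
  intro f hf
  have h := LinearMap.congr_fun hψ f
  have hf' : φ f = 0 := hf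
  simp only [LinearMap.comp_apply, AlgHom.toLinearMap_apply, hf', map_zero] at h
  exact Ideal.Quotient.eq_zero_iff_mem.1 h.symm

/-- The exponent vector of the image of a variable under the clique parametrization. -/
noncomputable def cliqueExponent (G : SimpleGraph (Fin m)) (r : Fin m → ℕ)
    (x : (v : Fin m) → Fin (r v)) : (Σ C : Finset (Fin m), ((v : C) → Fin (r v.1))) →₀ ℕ :=
  ∑ C ∈ maximalCliques G, Finsupp.single ⟨C, fun v => x v.1⟩ 1

theorem cliqueExponent_apply {G : SimpleGraph (Fin m)} {r : Fin m → ℕ}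
    {C : Finset (Fin m)} (hC : C ∈ maximalCliques G) (x : (v : Fin m) → Fin (r v))
    (y : (v : C) → Fin (r v.1)) [Decidable ((fun v : C => x v.1) = y)] :
    cliqueExponent G r x ⟨C, y⟩ = if (fun v : C => x v.1) = y then 1 else 0 := by
  classical
  rw [cliqueExponent, Finsupp.finsetSum_apply, Finset.sum_eq_single C]
  · simp [Finsupp.single_apply]
  · intro D _ hD
    rw [Finsupp.single_apply, if_neg]
    intro h
    exact hD (Sigma.mk.inj_iff.1 h).1
  · exact fun h => absurd hC h

theorem exists_maximalClique (G : SimpleGraph (Fin m)) {C : Finset (Fin m)}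
    (hC : G.IsClique (C : Set (Fin m))) : ∃ D ∈ maximalCliques G, C ⊆ D := by
  classical
  obtain ⟨D, hCD, hD⟩ := (Set.toFinite {D : Finset (Fin m) |
    G.IsClique (D : Set (Fin m))}).exists_le_maximal hC
  refine ⟨D, ?_, hCD⟩
  simp only [maximalCliques, Finset.mem_filter, Finset.mem_univ, true_and]
  exact ⟨hD.prop, fun E hE hDE => le_antisymm hDE (hD.le_of_ge hE hDE)⟩

/-- Multisets of states with the same image monomial have the same restrictions to cliques. -/
theorem map_restrict_eq_of_sum_cliqueExponent_eq {G : SimpleGraph (Fin m)} {r : Fin m → ℕ}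
    {S T : Multiset ((v : Fin m) → Fin (r v))}
    (h : (S.map (cliqueExponent G r)).sum = (T.map (cliqueExponent G r)).sum)
    {C : Finset (Fin m)} (hC : G.IsClique (C : Set (Fin m))) :
    S.map (fun x (v : C) => x v.1) = T.map (fun x (v : C) => x v.1) := by
  classical
  obtain ⟨D, hD, hCD⟩ := exists_maximalClique G hC
  have hcount : ∀ (S : Multiset ((v : Fin m) → Fin (r v))) (y : (v : D) → Fin (r v.1)),
      (S.map fun x (v : D) => x v.1).count y = (S.map (cliqueExponent G r)).sum ⟨D, y⟩ := by
    intro S y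
    induction S using Multiset.induction with
    | empty => simp
    | cons a S ih =>
      rw [Multiset.map_cons, Multiset.map_cons, Multiset.sum_cons, Finsupp.add_apply, ← ih,
        Multiset.count_cons, cliqueExponent_apply hD, add_comm]
      simp only [eq_comm]
  have hDmap : S.map (fun x (v : D) => x v.1) = T.map (fun x (v : D) => x v.1) := by
    ext y
    rw [hcount, hcount, h]
  have := congrArg (Multiset.map fun (z : (v : D) → Fin (r v.1)) (v : C) => z ⟨v.1, hCD v.2⟩) hDmap
  simpa only [Multiset.map_map, Function.comp_def] using this

theorem sameMarginal_of_map_restrict_eq {r : Fin m → ℕ} {ι : Type} [Fintype ι]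
    {C : Finset (Fin m)} {s t : ι → (v : Fin m) → Fin (r v)}
    (h : (Finset.univ.val.map s).map (fun x (v : C) => x v.1) =
      (Finset.univ.val.map t).map (fun x (v : C) => x v.1)) : SameMarginal C s t := by
  classical
  intro y
  have hcount : ∀ s : ι → (v : Fin m) → Fin (r v),
      (Finset.univ.filter fun i => ∀ v ∈ C, s i v = y v).card =
        ((Finset.univ.val.map s).map (fun x (v : C) => x v.1)).count (fun v : C => y v.1) := by
    intro s
    rw [Multiset.map_map, Multiset.count_map, ← Finset.filter_val, Finset.card_val]
    congr 1
    ext i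
    simp [funext_iff, eq_comm]
  rw [hcount, hcount, h]

theorem exists_fin_map_univ_eq {α : Type*} (S : Multiset α) {n : ℕ} (h : S.card = n) :
    ∃ s : Fin n → α, Finset.univ.val.map s = S := by
  subst h
  induction S using Quotient.inductionOn with
  | h l =>
    refine ⟨l.get, ?_⟩
    exact (Fin.univ_val_map l.get).trans (congrArg _ (List.ofFn_get l))

theorem IsChordal.graphicalModelIdeal_le_swapIdeal {G : SimpleGraph (Fin m)} (hG : IsChordal G)
    (r : Fin m → ℕ) : graphicalModelIdeal G r ≤ swapIdeal G r := by
  classical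
  have hmono : ∀ d : ((v : Fin m) → Fin (r v)) →₀ ℕ,
      (monomial d 1 : MvPolynomial ((v : Fin m) → Fin (r v)) ℝ) =
        (d.toMultiset.map X).prod := by
    intro d
    rw [monomial_eq, C_1, one_mul, Finsupp.toMultiset_map, Finsupp.prod_toMultiset,
      Finsupp.prod_mapDomain_index] <;> simp [pow_add]
  refine ker_le_of_monomial_sub_monomial_mem _
    (fun d => (d.toMultiset.map (cliqueExponent G r)).sum) ?_ _ ?_
  · intro d
    rw [hmono]
    induction d.toMultiset using Multiset.induction with
    | empty => simp
    | cons a S ih =>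
      rw [Multiset.map_cons, Multiset.map_cons, Multiset.prod_cons, Multiset.sum_cons, map_mul, ih,
        aeval_X, ← one_mul (1 : ℝ), ← monomial_mul, one_mul, cliqueExponent]
      congr 1
      rw [monomial_sum_one]
      rfl
  · intro d d' h
    have hrestrict := fun C (hC : G.IsClique ((C : Finset (Fin m)) : Set (Fin m))) =>
      map_restrict_eq_of_sum_cliqueExponent_eq h hC
    have hcard : d'.toMultiset.card = d.toMultiset.card := by
      have := congrArg Multiset.card (hrestrict ∅ (by simp))
      simpa only [Multiset.card_map] using this.symm
    obtain ⟨s, hs⟩ := exists_fin_map_univ_eq d.toMultiset rfl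
    obtain ⟨t, ht⟩ := exists_fin_map_univ_eq d'.toMultiset hcard
    rw [← hs, ← ht] at hrestrict
    have := hG.prod_sub_prod_mem s t fun C hC => sameMarginal_of_map_restrict_eq (hrestrict C hC)
    rw [hmono, hmono, ← hs, ← ht, Multiset.map_map, Multiset.map_map]
    exact this

/-- Geiger–Meek–Sturmfels: the vanishing ideal of the discrete
undirected graphical model of `G` equals the global Markov CI ideal iff `G` is
chordal. -/
theorem graphicalModelIdeal_eq_globalMarkovIdeal_iff_chordal
    (G : SimpleGraph (Fin m)) (r : Fin m → ℕ) (hr : ∀ v, 2 ≤ r v) :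
    graphicalModelIdeal G r = globalMarkovIdeal G r ↔ IsChordal G := by
  rw [globalMarkovIdeal_eq_swapIdeal]
  exact ⟨fun h => isChordal_of_graphicalModelIdeal_le_swapIdeal hr h.le, fun h =>
    le_antisymm (h.graphicalModelIdeal_le_swapIdeal r) (swapIdeal_le_graphicalModelIdeal G r)⟩
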